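/- Let Q : ℝ³ → ℝ be Q(x,y,t) := t² − x² − y², let Ω := {p ∈ ℝ³ : Q(p) > 0}, and let f : Ω → ℝ be f(p) := −(1/2)·log(Q(p)). Then the Hessian quadratic form of f is positive definite at every point of Ω: for every p ∈ Ω and every nonzero v ∈ ℝ³, D²f(p)(v, v) > 0. Equivalently, 2·B(p,v)²/Q(p)² − B(v,v)/Q(p) > 0 for all p ∈ Ω and v ≠ 0, where B is the polarization of Q. (Hence the Hessian quadratic form of f is a Riemannian metric on Ω.) -/

import Mathlib

/-- The Lorentzian quadratic form `Q(x,y,t) = t² − x² − y²` on `ℝ³`. -/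
def Qform (p : ℝ × ℝ × ℝ) : ℝ := p.2.2 ^ 2 - p.1 ^ 2 - p.2.1 ^ 2

/-- The polarization `B((x,y,t),(x',y',t')) = t t' − x x' − y y'` of `Q`. -/
def Bform (p q : ℝ × ℝ × ℝ) : ℝ := p.2.2 * q.2.2 - p.1 * q.1 - p.2.1 * q.2.1

/-- The potential `f = −(1/2)·log Q` on the cone `{Q > 0}`. -/
noncomputable def fpot (p : ℝ × ℝ × ℝ) : ℝ := -(1 / 2) * Real.log (Qform p)

/-- The polarization `B(p, ·)` as a continuous linear map in both arguments. -/
noncomputable def BformL : (ℝ × ℝ × ℝ) →L[ℝ] (ℝ × ℝ × ℝ) →L[ℝ] ℝ :=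
  let X := ContinuousLinearMap.fst ℝ ℝ (ℝ × ℝ)
  let Y := (ContinuousLinearMap.fst ℝ ℝ ℝ).comp (ContinuousLinearMap.snd ℝ ℝ (ℝ × ℝ))
  let T := (ContinuousLinearMap.snd ℝ ℝ ℝ).comp (ContinuousLinearMap.snd ℝ ℝ (ℝ × ℝ))
  T.smulRight T - X.smulRight X - Y.smulRight Y

@[simp]
theorem BformL_apply (p q : ℝ × ℝ × ℝ) : BformL p q = Bform p q := by
  simp [BformL, Bform]

theorem Bform_comm (p q : ℝ × ℝ × ℝ) : Bform p q = Bform q p := by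
  simp only [Bform]; ring

theorem Bform_self (p : ℝ × ℝ × ℝ) : Bform p p = Qform p := by
  simp only [Bform, Qform]; ring

theorem hasFDerivAt_Qform (p : ℝ × ℝ × ℝ) :
    HasFDerivAt Qform ((2 : ℝ) • BformL p) p := by
  have h := BformL.hasFDerivAt.clm_apply (hasFDerivAt_id (𝕜 := ℝ) p)
  refine (h.congr_of_eventuallyEq (f₁ := Qform) (.of_forall fun q => ?_)).congr_fderiv ?_
  · simp [Bform_self]
  · refine ContinuousLinearMap.ext fun v => ?_
    simp [Bform_comm v p, two_mul]

theorem hasFDerivAt_fpot {p : ℝ × ℝ × ℝ} (hp : 0 < Qform p) :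
    HasFDerivAt fpot (-(Qform p)⁻¹ • BformL p) p := by
  refine (((hasFDerivAt_Qform p).log hp.ne').const_mul (-(1 / 2))).congr_fderiv ?_
  refine ContinuousLinearMap.ext fun v => ?_
  simp
  ring

theorem fderiv_fderiv_fpot_apply {p : ℝ × ℝ × ℝ} (hp : 0 < Qform p) (v : ℝ × ℝ × ℝ) :
    fderiv ℝ (fderiv ℝ fpot) p v v =
      2 * (Bform p v) ^ 2 / (Qform p) ^ 2 - Bform v v / Qform p := by
  have hev : fderiv ℝ fpot =ᶠ[nhds p] fun q => -(Qform q)⁻¹ • BformL q := by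
    filter_upwards [(hasFDerivAt_Qform p).continuousAt.eventually (lt_mem_nhds hp)] with q hq
    exact (hasFDerivAt_fpot hq).fderiv
  have hinv : HasFDerivAt (fun q => -(Qform q)⁻¹)
      (-(-(Qform p ^ 2)⁻¹ • ((2 : ℝ) • BformL p))) p :=
    ((hasDerivAt_inv hp.ne').comp_hasFDerivAt p (hasFDerivAt_Qform p)).neg
  rw [hev.fderiv_eq, (hinv.fun_smul BformL.hasFDerivAt).fderiv]
  simp
  field_simp
  ring

/-- The strict inequality behind positive definiteness: for timelike `p` and `v ≠ 0`,
`Q(p) Q(v) < 2 B(p,v)²`. -/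
theorem Qform_mul_Bform_self_lt {p v : ℝ × ℝ × ℝ} (hp : 0 < Qform p) (hv : v ≠ 0) :
    Qform p * Bform v v < 2 * (Bform p v) ^ 2 := by
  obtain ⟨x, y, t⟩ := p
  obtain ⟨a, b, c⟩ := v
  have ht : t ≠ 0 := by
    rintro rfl
    simp only [Qform] at hp
    nlinarith [sq_nonneg x, sq_nonneg y]
  have hid : t ^ 2 * (2 * (Bform (x, y, t) (a, b, c)) ^ 2 -
      Qform (x, y, t) * Bform (a, b, c) (a, b, c)) =
      (t * Bform (x, y, t) (a, b, c)) ^ 2 + (x * (t * a - c * x) + y * (t * b - c * y)) ^ 2 +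
        Qform (x, y, t) * ((t * a - c * x) ^ 2 + (t * b - c * y) ^ 2) := by
    simp only [Qform, Bform]; ring
  by_contra! hle
  have hnonpos := mul_nonpos_of_nonneg_of_nonpos (sq_nonneg t) (sub_nonpos.2 hle)
  rw [hid] at hnonpos
  have hw := mul_nonneg hp.le (add_nonneg (sq_nonneg (t * a - c * x)) (sq_nonneg (t * b - c * y)))
  have hB := sq_nonneg (t * Bform (x, y, t) (a, b, c))
  have hs := sq_nonneg (x * (t * a - c * x) + y * (t * b - c * y))
  have hB0 : t * Bform (x, y, t) (a, b, c) = 0 := pow_eq_zero_iff two_ne_zero |>.1 (by linarith)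
  have hw0 : (t * a - c * x) ^ 2 + (t * b - c * y) ^ 2 = 0 :=
    (mul_eq_zero.1 (by linarith : Qform (x, y, t) * _ = 0)).resolve_left hp.ne'
  have ha : t * a - c * x = 0 := by
    nlinarith [sq_nonneg (t * a - c * x), sq_nonneg (t * b - c * y)]
  have hb : t * b - c * y = 0 := by
    nlinarith [sq_nonneg (t * a - c * x), sq_nonneg (t * b - c * y)]
  have hcQ : c * Qform (x, y, t) = 0 := by
    simp only [Bform, Qform] at hB0 ⊢
    linear_combination hB0 + x * ha + y * hb
  obtain rfl : c = 0 := (mul_eq_zero.1 hcQ).resolve_right hp.ne'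
  apply hv
  simp_all

/-- The Hessian quadratic form of `f = −(1/2)·log(t²−x²−y²)` is positive definite
at every point of the cone `{Q > 0}`: it is a Riemannian metric there. -/
theorem stmt9 : ∀ p : ℝ × ℝ × ℝ, 0 < Qform p → ∀ v : ℝ × ℝ × ℝ, v ≠ 0 →
    0 < fderiv ℝ (fderiv ℝ fpot) p v v ∧
    0 < 2 * (Bform p v) ^ 2 / (Qform p) ^ 2 - Bform v v / Qform p := by
  intro p hp v hv
  rw [fderiv_fderiv_fpot_apply hp v, and_self]
  have heq : 2 * (Bform p v) ^ 2 / (Qform p) ^ 2 - Bform v v / Qform p =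
      (2 * (Bform p v) ^ 2 - Qform p * Bform v v) / (Qform p) ^ 2 := by
    field_simp
  rw [heq]
  exact div_pos (sub_pos.2 (Qform_mul_Bform_self_lt hp hv)) (pow_pos hp 2)
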